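/- Let P1 and P2 be two augmented programs. Then P1 and P2 are strongly equivalent (for every program P, P1 ∪ P and P2 ∪ P have exactly the same answer sets) if and only if P1 and P2 are equivalent in the 3-valued Gödel logic G3 (they have exactly the same 3-valued models). -/

import Mathlib

namespace ASP

/-- Propositional formulas over atoms `α`, built with ∧, ∨, ← and ⊥.
`impl A B` denotes the formula `B ← A` (i.e. `A → B`). -/
inductive PropForm (α : Type) : Type
  | var : α → PropForm α
  | fals : PropForm α
  | conj : PropForm α → PropForm α → PropForm α
  | disj : PropForm α → PropForm α → PropForm α
  | impl : PropForm α → PropForm α → PropForm α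
  deriving DecidableEq

namespace PropForm

variable {α : Type}

/-- `¬F` abbreviates `⊥ ← F`. -/
def neg (A : PropForm α) : PropForm α := impl A fals

/-- `⊤` abbreviates `⊥ ← ⊥`. -/
def top : PropForm α := impl fals fals

/-- The set of atoms occurring in a formula. -/
def atoms : PropForm α → Set α
  | var a => {a}
  | fals => ∅
  | conj A B => atoms A ∪ atoms B
  | disj A B => atoms A ∪ atoms B
  | impl A B => atoms A ∪ atoms B

end PropForm

open PropForm

/-- Hilbert-style derivability for intuitionistic propositional logic,
with an extra set `Ax` of additional axioms. -/
inductive Deriv {α : Type} (Ax : Set (PropForm α)) : PropForm α → Prop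
  | ax {A} : A ∈ Ax → Deriv Ax A
  | k (A B) : Deriv Ax (impl A (impl B A))
  | s (A B C) : Deriv Ax (impl (impl A (impl B C)) (impl (impl A B) (impl A C)))
  | conjIntro (A B) : Deriv Ax (impl A (impl B (conj A B)))
  | conjElimL (A B) : Deriv Ax (impl (conj A B) A)
  | conjElimR (A B) : Deriv Ax (impl (conj A B) B)
  | disjIntroL (A B) : Deriv Ax (impl A (disj A B))
  | disjIntroR (A B) : Deriv Ax (impl B (disj A B))
  | disjElim (A B C) : Deriv Ax (impl (impl A C) (impl (impl B C) (impl (disj A B) C)))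
  | falsElim (A) : Deriv Ax (impl fals A)
  | mp {A B} : Deriv Ax (impl A B) → Deriv Ax A → Deriv Ax B

/-- `F` is a theorem of intuitionistic propositional logic. -/
def IThm {α : Type} (F : PropForm α) : Prop := Deriv ∅ F

/-- `F` is a theorem of classical propositional logic
(intuitionistic logic plus double-negation elimination). -/
def CThm {α : Type} (F : PropForm α) : Prop :=
  Deriv {F | ∃ A, F = impl (neg (neg A)) A} F

/-- Conjunction of a finite list of formulas (empty conjunction is ⊤). -/
def bigConj {α : Type} : List (PropForm α) → PropForm α
  | [] => top
  | [A] => A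
  | A :: L => conj A (bigConj L)

/-- Disjunction of a finite list of formulas (empty disjunction is ⊥). -/
def bigDisj {α : Type} : List (PropForm α) → PropForm α
  | [] => fals
  | [A] => A
  | A :: L => disj A (bigDisj L)

/-- `T ⊢_X F`: the formula `F ← (F₁ ∧ ... ∧ Fₙ)` is a theorem of the logic
whose theorems are `Thm`, for some `F₁, ..., Fₙ ∈ T`. -/
def ProvesFrom {α : Type} (Thm : PropForm α → Prop) (T : Set (PropForm α))
    (F : PropForm α) : Prop :=
  ∃ L : List (PropForm α), (∀ G ∈ L, G ∈ T) ∧ Thm (impl (bigConj L) F)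

/-- `T ⊢_I F`. -/
def IProves {α : Type} (T : Set (PropForm α)) (F : PropForm α) : Prop :=
  ProvesFrom IThm T F

/-- `T ⊢_C F`. -/
def CProves {α : Type} (T : Set (PropForm α)) (F : PropForm α) : Prop :=
  ProvesFrom CThm T F

/-- `T` is consistent in intuitionistic logic. -/
def IConsistent {α : Type} (T : Set (PropForm α)) : Prop := ¬ IProves T fals

/-- `T ⊩_I M`: `T` is consistent and proves (intuitionistically) every atom of `M`. -/
def IProvesAll {α : Type} (T : Set (PropForm α)) (M : Set α) : Prop :=
  IConsistent T ∧ ∀ a ∈ M, IProves T (var a)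

/-- `T ≡_I U`: the two theories prove each other's formulas intuitionistically. -/
def IEquivTh {α : Type} (T U : Set (PropForm α)) : Prop :=
  (∀ F ∈ U, IProves T F) ∧ (∀ F ∈ T, IProves U F)

/-- The signature (set of occurring atoms) of a theory. -/
def sigTh {α : Type} (T : Set (PropForm α)) : Set α := ⋃ F ∈ T, F.atoms

/-- `T` is (literal) complete: for every atom `a` of its signature,
`T ⊢_I a` or `T ⊢_I ¬a`. -/
def IComplete {α : Type} (T : Set (PropForm α)) : Prop :=
  ∀ a ∈ sigTh T, IProves T (var a) ∨ IProves T (neg (var a))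

/-- `{¬a : a ∈ S}`. -/
def negSet {α : Type} (S : Set α) : Set (PropForm α) := (fun a => neg (var a)) '' S

/-- `{¬¬a : a ∈ S}`. -/
def negnegSet {α : Type} (S : Set α) : Set (PropForm α) :=
  (fun a => neg (neg (var a))) '' S

/-- Classical two-valued satisfaction, identifying an interpretation with the
set of atoms it makes true. -/
def sat2 {α : Type} (X : Set α) : PropForm α → Prop
  | .var a => a ∈ X
  | .fals => False
  | .conj A B => sat2 X A ∧ sat2 X B
  | .disj A B => sat2 X A ∨ sat2 X B
  | .impl A B => sat2 X A → sat2 X B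

/-- `X` is a classical model of the theory `T`. -/
def isModel2 {α : Type} (X : Set α) (T : Set (PropForm α)) : Prop := ∀ F ∈ T, sat2 X F

/-- `M` is a minimal (under ⊆) classical model of `T`. -/
def isMinModel {α : Type} (T : Set (PropForm α)) (M : Set α) : Prop :=
  isModel2 M T ∧ ∀ N ⊆ M, isModel2 N T → N = M

/-- Evaluation in the 3-valued Gödel logic G3. -/
def g3 {α : Type} (I : α → Fin 3) : PropForm α → Fin 3
  | .var a => I a
  | .fals => 0
  | .conj A B => min (g3 I A) (g3 I B)
  | .disj A B => max (g3 I A) (g3 I B)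
  | .impl A B => if g3 I A ≤ g3 I B then 2 else g3 I B

/-- Nested formulas: built from atoms, ⊤ and ⊥ using ∧, ∨ and ¬. -/
inductive NF (α : Type) : Type
  | var : α → NF α
  | top : NF α
  | bot : NF α
  | conj : NF α → NF α → NF α
  | disj : NF α → NF α → NF α
  | neg : NF α → NF α
  deriving DecidableEq

namespace NF

variable {α : Type}

/-- Reading a nested formula as a propositional formula
(`⊤ = ⊥ ← ⊥` and `¬F = ⊥ ← F`). -/
def toProp : NF α → PropForm α
  | var a => .var a
  | top => PropForm.top
  | bot => .fals
  | conj A B => .conj (toProp A) (toProp B)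
  | disj A B => .disj (toProp A) (toProp B)
  | neg A => PropForm.neg (toProp A)

/-- Atoms occurring in a nested formula. -/
def atoms : NF α → Set α
  | var a => {a}
  | top => ∅
  | bot => ∅
  | conj A B => atoms A ∪ atoms B
  | disj A B => atoms A ∪ atoms B
  | neg A => atoms A

/-- Satisfaction of a (basic, negation-free) nested formula by a set of atoms. -/
def satB (X : Set α) : NF α → Prop
  | var a => a ∈ X
  | top => True
  | bot => False
  | conj A B => satB X A ∧ satB X B
  | disj A B => satB X A ∨ satB X B
  | neg A => ¬ satB X A

open scoped Classical in
/-- The reduct `F^X`: each maximal subformula `¬G` is replaced by ⊥ if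
`X ⊨ G^X` and by ⊤ otherwise. -/
noncomputable def reduct (X : Set α) : NF α → NF α
  | var a => var a
  | top => top
  | bot => bot
  | conj A B => conj (reduct X A) (reduct X B)
  | disj A B => disj (reduct X A) (reduct X B)
  | neg A => if satB X (reduct X A) then bot else top

end NF

/-- An augmented clause `H ← B` is a pair `(H, B)` of nested formulas. -/
abbrev AugClause (α : Type) := NF α × NF α

/-- The propositional formula `H ← B` of an augmented clause. -/
def clauseToProp {α : Type} (c : AugClause α) : PropForm α :=
  .impl c.2.toProp c.1.toProp

/-- The theory of an augmented program. -/
def progTh {α : Type} (P : List (AugClause α)) : Set (PropForm α) :=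
  {F | ∃ c ∈ P, clauseToProp c = F}

/-- The signature of an augmented program. -/
def progSig {α : Type} (P : List (AugClause α)) : Set α :=
  {a | ∃ c ∈ P, a ∈ c.1.atoms ∪ c.2.atoms}

/-- `X` is closed under the (basic) program `P`: for each clause `H ← B`,
`X ⊨ H` whenever `X ⊨ B`. -/
def closedUnder {α : Type} (X : Set α) (P : List (AugClause α)) : Prop :=
  ∀ c ∈ P, NF.satB X c.2 → NF.satB X c.1

/-- The reduct `P^X` of an augmented program. -/
noncomputable def progReduct {α : Type} (X : Set α) (P : List (AugClause α)) :
    List (AugClause α) :=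
  P.map fun c => (c.1.reduct X, c.2.reduct X)

/-- `M` is an answer set of `P`: `M` is minimal (under ⊆) among the sets of
atoms closed under the reduct `P^M`. -/
def isAnswerSet {α : Type} (P : List (AugClause α)) (M : Set α) : Prop :=
  closedUnder M (progReduct M P) ∧ ∀ N ⊆ M, closedUnder N (progReduct M P) → N = M

/-- `M` is a min-answer set of `P`: both an answer set and a minimal model. -/
def isMinAnswerSet {α : Type} (P : List (AugClause α)) (M : Set α) : Prop :=
  isAnswerSet P M ∧ isMinModel (progTh P) M

/-- A G3 interpretation models an augmented program. -/
def g3ModelsProg {α : Type} (I : α → Fin 3) (P : List (AugClause α)) : Prop :=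
  ∀ c ∈ P, g3 I (clauseToProp c) = 2

/-- A free clause: a list of head literals and a list of body literals,
a literal being an atom `(a, true)` or a negated atom `(a, false)`.
It denotes `h₁ ∨ ... ∨ hₙ ← b₁ ∧ ... ∧ bₘ` (empty head = ⊥, empty body = ⊤). -/
structure FClause (α : Type) where
  head : List (α × Bool)
  body : List (α × Bool)
  deriving DecidableEq

/-- The propositional formula of a literal. -/
def litToProp {α : Type} : α × Bool → PropForm α
  | (a, true) => .var a
  | (a, false) => PropForm.neg (.var a)

/-- The nested formula of a literal. -/
def litToNF {α : Type} : α × Bool → NF α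
  | (a, true) => .var a
  | (a, false) => .neg (.var a)

/-- Disjunction of a list of nested formulas (empty = ⊥). -/
def bigDisjNF {α : Type} : List (NF α) → NF α
  | [] => .bot
  | [A] => A
  | A :: L => .disj A (bigDisjNF L)

/-- Conjunction of a list of nested formulas (empty = ⊤). -/
def bigConjNF {α : Type} : List (NF α) → NF α
  | [] => .top
  | [A] => A
  | A :: L => .conj A (bigConjNF L)

namespace FClause

variable {α : Type}

/-- The propositional formula of a free clause. -/
def toProp (c : FClause α) : PropForm α :=
  .impl (bigConj (c.body.map litToProp)) (bigDisj (c.head.map litToProp))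

/-- A free clause as an augmented clause. -/
def toAug (c : FClause α) : AugClause α :=
  (bigDisjNF (c.head.map litToNF), bigConjNF (c.body.map litToNF))

/-- The atoms of a free clause. -/
def atomsF (c : FClause α) : Set α :=
  {a | (∃ b, (a, b) ∈ c.head) ∨ (∃ b, (a, b) ∈ c.body)}

/-- A general clause: all head literals are positive atoms. -/
def isGeneral (c : FClause α) : Prop := ∀ l ∈ c.head, l.2 = true

/-- A disjunctive clause: a general clause with nonempty head. -/
def isDisjunctive (c : FClause α) : Prop := c.isGeneral ∧ c.head ≠ []

/-- A constraint: a clause with empty head (head ⊥). -/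
def isConstraint (c : FClause α) : Prop := c.head = []

end FClause

/-- The theory of a free program. -/
def fTh {α : Type} (P : List (FClause α)) : Set (PropForm α) :=
  {F | ∃ c ∈ P, c.toProp = F}

/-- The signature of a free program. -/
def fSig {α : Type} (P : List (FClause α)) : Set α :=
  {a | ∃ c ∈ P, a ∈ c.atomsF}

/-- `GenDisj(P)`: each constraint `⊥ ← B` is replaced by `p ← B ∧ ¬p`,
where `p` is a new reserved atom. -/
def genDisj {α : Type} [DecidableEq α] (P : List (FClause α)) (p : α) :
    List (FClause α) :=
  P.map fun c =>
    if c.head = [] then ⟨[(p, true)], c.body ++ [(p, false)]⟩ else c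

/-- The atoms `a` such that `¬a` occurs in the head of some clause of `P`
(the set `S` of the FreeGen transformation), as a list. -/
def headNegs {α : Type} (P : List (FClause α)) : List α :=
  P.flatMap fun c => c.head.filterMap fun l => if l.2 = false then some l.1 else none

open scoped Classical in
/-- Replace the occurrence of `¬a` (for `a ∈ S`) by the positive atom `φ a`. -/
noncomputable def substLit {α : Type} (S : Set α) (φ : α → α) (l : α × Bool) :
    α × Bool :=
  if l.2 = false ∧ l.1 ∈ S then (φ l.1, true) else l

/-- Replace every occurrence of `¬a` (for `a ∈ S`) by `φ a` in a clause. -/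
noncomputable def FClause.subst {α : Type} (S : Set α) (φ : α → α) (c : FClause α) :
    FClause α :=
  ⟨c.head.map (substLit S φ), c.body.map (substLit S φ)⟩

/-- `Δ_S = ⋃_{a ∈ S} {φ(a) ← ¬a, ⊥ ← a ∧ φ(a)}`. -/
def deltaClauses {α : Type} (L : List α) (φ : α → α) : List (FClause α) :=
  L.flatMap fun a => [⟨[(φ a, true)], [(a, false)]⟩, ⟨[], [(a, true), (φ a, true)]⟩]

/-- `FreeGen(P) = P' ∪ Δ_S`. -/
noncomputable def freeGen {α : Type} (P : List (FClause α)) (φ : α → α) :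
    List (FClause α) :=
  P.map (FClause.subst {a | a ∈ headNegs P} φ) ++ deltaClauses (headNegs P) φ

open scoped Classical in
/-- The second reduction `redu2(P; ¬¬M)`: clauses whose body contains a literal
`¬a` with `a ∈ M` are deleted; in constraints, positive body literals `a ∈ M`
are deleted. -/
noncomputable def redu2 {α : Type} [DecidableEq α] (P : List (FClause α))
    (M : Set α) : List (FClause α) :=
  (P.filter fun c => decide (¬ ∃ l ∈ c.body, l.2 = false ∧ l.1 ∈ M)).map
    fun c =>
      if c.head = [] then
        ⟨[], c.body.filter fun l => decide (¬ (l.2 = true ∧ l.1 ∈ M))⟩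
      else c

/-- `P₂` is a conservative extension of `P₁`: `M₁` is an answer set of `P₁`
iff `M₂` is an answer set of `P₂`, where `M₁ = M₂ ∩ σ_{P₁}`. -/
def consExt {α : Type} (P1 P2 : List (AugClause α)) : Prop :=
  (∀ M2 : Set α, isAnswerSet P2 M2 → isAnswerSet P1 (M2 ∩ progSig P1)) ∧
  (∀ M1 : Set α, isAnswerSet P1 M1 →
    ∃ M2 : Set α, isAnswerSet P2 M2 ∧ M1 = M2 ∩ progSig P1)

/-- `P₂` is a strong conservative extension of the user program `P₁` (relative
to the user signature `U`): for every user program `P`, `P₂ ∪ P` is a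
conservative extension of `P₁ ∪ P`. -/
def strongConsExt {α : Type} (P1 P2 : List (AugClause α)) (U : Set α) : Prop :=
  ∀ P : List (AugClause α), progSig P ⊆ U → consExt (P1 ++ P) (P2 ++ P)

mutual
  /-- Negation normal form: push negations inward (no pending negation). -/
  def nnf0 {α : Type} : NF α → NF α
    | .var a => .var a
    | .top => .top
    | .bot => .bot
    | .conj A B => .conj (nnf0 A) (nnf0 B)
    | .disj A B => .disj (nnf0 A) (nnf0 B)
    | .neg A => nnf1 A
  /-- Negation normal form under one pending negation. -/
  def nnf1 {α : Type} : NF α → NF α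
    | .var a => .neg (.var a)
    | .top => .bot
    | .bot => .top
    | .conj A B => .disj (nnf1 A) (nnf1 B)
    | .disj A B => .conj (nnf1 A) (nnf1 B)
    | .neg A => nnf2 A
  /-- Negation normal form under two pending negations. -/
  def nnf2 {α : Type} : NF α → NF α
    | .var a => .neg (.neg (.var a))
    | .top => .top
    | .bot => .bot
    | .conj A B => .conj (nnf2 A) (nnf2 B)
    | .disj A B => .disj (nnf2 A) (nnf2 B)
    | .neg A => nnf1 A
end

/-- Conjunctive normal form (list of disjunction-lists of leaves). -/
def cnfNF {α : Type} : NF α → List (List (NF α))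
  | .conj A B => cnfNF A ++ cnfNF B
  | .disj A B => (cnfNF A).flatMap fun c => (cnfNF B).map fun d => c ++ d
  | F => [[F]]

/-- Disjunctive normal form (list of conjunction-lists of leaves). -/
def dnfNF {α : Type} : NF α → List (List (NF α))
  | .disj A B => dnfNF A ++ dnfNF B
  | .conj A B => (dnfNF A).flatMap fun c => (dnfNF B).map fun d => c ++ d
  | F => [[F]]

/-- Read a leaf as a literal (if it is one). -/
def leafLit {α : Type} : NF α → Option (α × Bool)
  | .var a => some (a, true)
  | .neg (.var a) => some (a, false)
  | _ => none

/-- Read a leaf `¬¬a` as the literal `¬a` to be moved to the other side. -/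
def dnegLit {α : Type} : NF α → Option (α × Bool)
  | .neg (.neg (.var a)) => some (a, false)
  | _ => none

/-- Build a free clause from a head disjunct-list and a body conjunct-list:
doubly negated atoms `¬¬a` in the head become `¬a` in the body and vice versa;
trivial clauses (⊤ in the head or ⊥ in the body) are removed. -/
def procClause {α : Type} [DecidableEq α] (hd bd : List (NF α)) :
    Option (FClause α) :=
  if NF.top ∈ hd ∨ NF.bot ∈ bd then none
  else some ⟨hd.filterMap leafLit ++ bd.filterMap dnegLit,
             bd.filterMap leafLit ++ hd.filterMap dnegLit⟩

/-- `AugFree(P)`: the free program obtained from the augmented program `P` by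
pushing negations inward, taking CNF of heads and DNF of bodies, splitting
conjunctions in heads and disjunctions in bodies into separate clauses, and
eliminating doubly negated atoms. -/
def augFree {α : Type} [DecidableEq α] (P : List (AugClause α)) :
    List (FClause α) :=
  P.flatMap fun c =>
    (cnfNF (nnf0 c.1)).flatMap fun hd =>
      (dnfNF (nnf0 c.2)).filterMap fun bd => procClause hd bd

/-- Positive formulas: no negation (in particular no ⊥) occurs. -/
def IsPositive {α : Type} : PropForm α → Prop
  | .var _ => True
  | .fals => False
  | .conj A B => IsPositive A ∧ IsPositive B
  | .disj A B => IsPositive A ∧ IsPositive B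
  | .impl A B => IsPositive A ∧ IsPositive B

/-- The set 𝐍 of two-negated formulas. -/
inductive IsTwoNeg {α : Type} : PropForm α → Prop
  | atom (a : α) : IsTwoNeg (neg (neg (var a)))
  | dneg {A} : IsTwoNeg A → IsTwoNeg (neg (neg A))
  | conj {A B} : IsTwoNeg A → IsTwoNeg B → IsTwoNeg (PropForm.conj A B)
  | disjL {A} (B) : IsTwoNeg A → IsTwoNeg (PropForm.disj A B)
  | disjR {A} (B) : IsTwoNeg A → IsTwoNeg (PropForm.disj B A)
  | himp {A} (B) : IsTwoNeg A → IsTwoNeg (PropForm.impl B A)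

theorem NF.atoms_finite {α : Type} (F : NF α) : F.atoms.Finite := by
  induction F with
  | var a => exact Set.finite_singleton a
  | top | bot => exact Set.finite_empty
  | conj A B ihA ihB | disj A B ihA ihB => exact ihA.union ihB
  | neg A ih => exact ih

theorem progSig_finite {α : Type} (P : List (AugClause α)) : (progSig P).Finite := by
  have h : progSig P = ⋃ c ∈ {c | c ∈ P}, (c.1.atoms ∪ c.2.atoms) := by
    ext a
    simp [progSig]
  rw [h]
  exact P.finite_toSet.biUnion fun c _ => c.1.atoms_finite.union c.2.atoms_finite

theorem g3_toProp_congr {α : Type} {I J : α → Fin 3} (F : NF α)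
    (h : ∀ a ∈ F.atoms, I a = J a) : g3 I F.toProp = g3 J F.toProp := by
  induction F with
  | var a => exact h a rfl
  | top | bot => rfl
  | conj A B ihA ihB | disj A B ihA ihB =>
    simp only [NF.toProp, g3, ihA fun a ha => h a (Or.inl ha),
      ihB fun a ha => h a (Or.inr ha)]
  | neg A ih =>
    simp only [NF.toProp, PropForm.neg, g3, ih h]
    rfl

theorem g3ModelsProg_congr {α : Type} {I J : α → Fin 3} (P : List (AugClause α))
    (h : ∀ a ∈ progSig P, I a = J a) : g3ModelsProg I P ↔ g3ModelsProg J P := by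
  refine forall₂_congr fun c hc => ?_
  simp only [clauseToProp, g3,
    g3_toProp_congr c.1 fun a ha => h a ⟨c, hc, Or.inl ha⟩,
    g3_toProp_congr c.2 fun a ha => h a ⟨c, hc, Or.inr ha⟩]

/-- A G3 interpretation evaluates the reduct in the "here" world `{a | I a = 2}` and in the
"there" world `{a | I a ≠ 0}`. -/
theorem g3_toProp_iff {α : Type} (I : α → Fin 3) (F : NF α) :
    (g3 I F.toProp = 2 ↔ NF.satB {a | I a = 2} (F.reduct {a | I a ≠ 0})) ∧
      (g3 I F.toProp ≠ 0 ↔ NF.satB {a | I a ≠ 0} (F.reduct {a | I a ≠ 0})) := by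
  induction F with
  | var a => exact ⟨Iff.rfl, Iff.rfl⟩
  | top => simp [NF.toProp, PropForm.top, g3, NF.reduct, NF.satB]
  | bot => simp [NF.toProp, g3, NF.reduct, NF.satB]
  | conj A B ihA ihB =>
    simp only [NF.toProp, g3, NF.reduct, NF.satB, ← ihA.1, ← ihA.2, ← ihB.1, ← ihB.2]
    generalize g3 I A.toProp = x
    generalize g3 I B.toProp = y
    revert x y
    decide
  | disj A B ihA ihB =>
    simp only [NF.toProp, g3, NF.reduct, NF.satB, ← ihA.1, ← ihA.2, ← ihB.1, ← ihB.2]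
    generalize g3 I A.toProp = x
    generalize g3 I B.toProp = y
    revert x y
    decide
  | neg A ih =>
    simp only [NF.toProp, PropForm.neg, g3, NF.reduct, ← ih.2]
    by_cases h : g3 I A.toProp = 0 <;> simp [h, NF.satB]

theorem closedUnder_progReduct {α : Type} (N M : Set α) (P : List (AugClause α)) :
    closedUnder N (progReduct M P) ↔
      ∀ c ∈ P, NF.satB N (c.2.reduct M) → NF.satB N (c.1.reduct M) := by
  simp only [closedUnder, progReduct, List.forall_mem_map]

theorem closedUnder_progReduct_append {α : Type} (N M : Set α) (P Q : List (AugClause α)) :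
    closedUnder N (progReduct M (P ++ Q)) ↔
      closedUnder N (progReduct M P) ∧ closedUnder N (progReduct M Q) := by
  simp only [closedUnder_progReduct, List.mem_append, or_imp, forall_and]

theorem g3ModelsProg_iff {α : Type} (I : α → Fin 3) (P : List (AugClause α)) :
    g3ModelsProg I P ↔
      closedUnder {a | I a = 2} (progReduct {a | I a ≠ 0} P) ∧
        closedUnder {a | I a ≠ 0} (progReduct {a | I a ≠ 0} P) := by
  simp only [closedUnder_progReduct, ← forall_and, g3ModelsProg]
  refine forall₂_congr fun c _ => ?_
  simp only [clauseToProp, g3, ← (g3_toProp_iff I _).1, ← (g3_toProp_iff I _).2]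
  generalize g3 I c.1.toProp = x
  generalize g3 I c.2.toProp = y
  revert x y
  decide

open scoped Classical in
/-- The G3 interpretation with "here" world `N` and "there" world `M`. -/
noncomputable def g3OfPair {α : Type} (N M : Set α) (a : α) : Fin 3 :=
  if a ∈ N then 2 else if a ∈ M then 1 else 0

theorem g3ModelsProg_g3OfPair {α : Type} {N M : Set α} (h : N ⊆ M) (P : List (AugClause α)) :
    g3ModelsProg (g3OfPair N M) P ↔
      closedUnder N (progReduct M P) ∧ closedUnder M (progReduct M P) := by
  have hN : {a | g3OfPair N M a = 2} = N := by
    ext a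
    by_cases hN : a ∈ N <;> by_cases hM : a ∈ M <;> simp [g3OfPair, hN, hM]
  have hM : {a | g3OfPair N M a ≠ 0} = M := by
    ext a
    by_cases hN : a ∈ N
    · simp [g3OfPair, hN, h hN]
    · by_cases hM : a ∈ M <;> simp [g3OfPair, hN, hM]
  rw [g3ModelsProg_iff, hN, hM]

theorem isAnswerSet_append_of_g3 {α : Type} {P1 P2 : List (AugClause α)}
    (h : ∀ I : α → Fin 3, g3ModelsProg I P1 ↔ g3ModelsProg I P2)
    {P : List (AugClause α)} {M : Set α} (hM : isAnswerSet (P1 ++ P) M) :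
    isAnswerSet (P2 ++ P) M := by
  simp only [isAnswerSet, closedUnder_progReduct_append] at hM ⊢
  obtain ⟨⟨hM1, hMP⟩, hmin⟩ := hM
  have hM2 := ((g3ModelsProg_g3OfPair subset_rfl P2).1
    ((h _).1 ((g3ModelsProg_g3OfPair subset_rfl P1).2 ⟨hM1, hM1⟩))).1
  refine ⟨⟨hM2, hMP⟩, fun N hN hc => hmin N hN ⟨?_, hc.2⟩⟩
  exact ((g3ModelsProg_g3OfPair hN P1).1
    ((h _).2 ((g3ModelsProg_g3OfPair hN P2).2 ⟨hc.1, hM2⟩))).1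

/-- The facts `a ← ⊤` for the atoms `a` of a list. -/
def factsProg {α : Type} (L : List α) : List (AugClause α) :=
  L.map fun a => (.var a, .top)

/-- The clauses `a ← b` for all atoms `a`, `b` of a list. -/
def loopProg {α : Type} (L : List α) : List (AugClause α) :=
  L.flatMap fun a => L.map fun b => (.var a, .var b)

theorem closedUnder_factsProg {α : Type} (N M : Set α) (L : List α) :
    closedUnder N (progReduct M (factsProg L)) ↔ ∀ a ∈ L, a ∈ N := by
  simp [closedUnder_progReduct, factsProg, NF.reduct, NF.satB]

theorem closedUnder_loopProg {α : Type} (N M : Set α) (L : List α) :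
    closedUnder N (progReduct M (loopProg L)) ↔ ∀ a ∈ L, ∀ b ∈ L, b ∈ N → a ∈ N := by
  simp only [closedUnder_progReduct, loopProg, List.mem_flatMap, List.mem_map]
  constructor
  · intro h a ha b hb
    exact h _ ⟨a, ha, b, hb, rfl⟩
  · rintro h _ ⟨a, ha, b, hb, rfl⟩
    exact h a ha b hb

theorem closedUnder_of_forall_isAnswerSet {α : Type} {P1 P2 : List (AugClause α)}
    (h : ∀ P : List (AugClause α), ∀ M : Set α,
      isAnswerSet (P1 ++ P) M ↔ isAnswerSet (P2 ++ P) M)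
    {N M : Set α} (hfin : M.Finite) (hNM : N ⊆ M)
    (hN1 : closedUnder N (progReduct M P1)) (hM1 : closedUnder M (progReduct M P1)) :
    closedUnder N (progReduct M P2) ∧ closedUnder M (progReduct M P2) := by
  simp only [isAnswerSet, closedUnder_progReduct_append] at h
  have hlist : ∀ S ⊆ M, ∃ L : List α, ∀ a, a ∈ L ↔ a ∈ S := fun S hS =>
    ⟨(hfin.subset hS).toFinset.toList, by simp⟩
  obtain ⟨LM, hLM⟩ := hlist M subset_rfl
  obtain ⟨LN, hLN⟩ := hlist N hNM
  obtain ⟨LD, hLD⟩ := hlist (M \ N) Set.sdiff_subset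
  have hM2 : closedUnder M (progReduct M P2) := by
    refine ((h (factsProg LM) M).1 ⟨⟨hM1, ?_⟩, fun K hK hc => ?_⟩).1.1
    · simp [closedUnder_factsProg, hLM]
    · simp only [closedUnder_factsProg, hLM] at hc
      exact hK.antisymm hc.2
  refine ⟨?_, hM2⟩
  by_contra hN2
  have hans := (h (factsProg LN ++ loopProg LD) M).2
  simp only [closedUnder_progReduct_append, closedUnder_factsProg, closedUnder_loopProg,
    hLN, hLD] at hans
  have hmin := (hans ⟨⟨hM2, fun a ha => hNM ha, fun a ha _ _ _ => ha.1⟩, ?_⟩).2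
  · have : N = M := hmin N hNM ⟨hN1, fun a ha => ha, fun _ _ b hb hbN => absurd hbN hb.2⟩
    exact hN2 (this ▸ hM2)
  · rintro K hK ⟨hK2, hNK, hloop⟩
    have hne : ¬ K ⊆ N := fun hKN => hN2 (hKN.antisymm hNK ▸ hK2)
    obtain ⟨b, hbK, hbN⟩ := Set.not_subset.1 hne
    refine hK.antisymm fun a ha => ?_
    by_cases haN : a ∈ N
    · exact hNK a haN
    · exact hloop a ⟨ha, haN⟩ b ⟨hK hbK, hbN⟩ hbK

theorem g3ModelsProg_of_forall_isAnswerSet {α : Type} {P1 P2 : List (AugClause α)}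
    (h : ∀ P : List (AugClause α), ∀ M : Set α,
      isAnswerSet (P1 ++ P) M ↔ isAnswerSet (P2 ++ P) M)
    {I : α → Fin 3} (hI : g3ModelsProg I P1) : g3ModelsProg I P2 := by
  classical
  let J : α → Fin 3 := fun a => if a ∈ progSig P1 ∪ progSig P2 then I a else 0
  have hIJ : ∀ a ∈ progSig P1 ∪ progSig P2, I a = J a := fun a ha => (if_pos ha).symm
  rw [g3ModelsProg_congr P1 fun a ha => hIJ a (Or.inl ha), g3ModelsProg_iff] at hI
  rw [g3ModelsProg_congr P2 fun a ha => hIJ a (Or.inr ha), g3ModelsProg_iff]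
  refine closedUnder_of_forall_isAnswerSet h ?_ ?_ hI.1 hI.2
  · refine ((progSig_finite P1).union (progSig_finite P2)).subset fun a ha => ?_
    by_contra hn
    exact ha (if_neg hn)
  · intro a (ha : J a = 2)
    simp [ha]

/-- two augmented programs are strongly equivalent (under the
answer set semantics) iff they have exactly the same G3 models. -/
theorem strong_equivalence_iff_g3 {α : Type} (P1 P2 : List (AugClause α)) :
    (∀ P : List (AugClause α), ∀ M : Set α,
        isAnswerSet (P1 ++ P) M ↔ isAnswerSet (P2 ++ P) M) ↔
      (∀ I : α → Fin 3, g3ModelsProg I P1 ↔ g3ModelsProg I P2) := by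
  exact ⟨fun h I => ⟨g3ModelsProg_of_forall_isAnswerSet h,
      g3ModelsProg_of_forall_isAnswerSet fun P M => (h P M).symm⟩,
    fun h P M => ⟨isAnswerSet_append_of_g3 h, isAnswerSet_append_of_g3 fun I => (h I).symm⟩⟩

end ASP
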